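/- arXiv:2502.02887 — 4 statements merged into one kernel-verified Lean document; each statement's English description precedes it below -/
import Mathlib

section
/- Let Q be a probability measure on ℝ^m, let λ ≠ 0, assume K_{h,Q,x}(−λ) is finite, and assume h(x,·) is integrable with respect to Q. Then −(1/λ) K_{h,Q,x}(−λ) = ∫ h(x,y) dQ(y) − (1/λ) D(Q‖P^{(h,Q,λ)}_{Y|X=x}), where P^{(h,Q,λ)}_{Y|X=x} is the (h,Q,λ)-Gibbs probability measure (note that Q ≪ P^{(h,Q,λ)}_{Y|X=x} since the Radon–Nikodym derivative dP^{(h,Q,λ)}_{Y|X=x}/dQ is everywhere strictly positive). -/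
open MeasureTheory Real ProbabilityTheory

/-- Real-valued relative entropy (KL divergence) `D(μ‖ν) = ∫ log (dμ/dν) dμ`. -/
noncomputable def klDivR {α : Type*} [MeasurableSpace α] (μ ν : Measure α) : ℝ :=
  ∫ y, Real.log ((μ.rnDeriv ν y).toReal) ∂μ

/-- `cgfK h Q x t = K_{h,Q,x}(t) = log ∫ exp (t * h x y) dQ(y)`. -/
noncomputable def cgfK {n m : ℕ} (h : (Fin n → ℝ) → (Fin m → ℝ) → ℝ)
    (Q : Measure (Fin m → ℝ)) (x : Fin n → ℝ) (t : ℝ) : ℝ :=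
  Real.log (∫ y, Real.exp (t * h x y) ∂Q)

/-- The `(h,Q,λ)`-Gibbs probability measure `P^{(h,Q,λ)}_{Y|X=x}`, which has density
`exp (-λ * h(x,y) - K_{h,Q,x}(-λ))` with respect to `Q`. -/
noncomputable def gibbs {n m : ℕ} (h : (Fin n → ℝ) → (Fin m → ℝ) → ℝ)
    (Q : Measure (Fin m → ℝ)) (lam : ℝ) (x : Fin n → ℝ) : Measure (Fin m → ℝ) :=
  Q.withDensity fun y => ENNReal.ofReal (Real.exp (-lam * h x y - cgfK h Q x (-lam)))

/-- When the normalizing integral is positive, the Gibbs measure is the exponential tilting of `Q`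
by `-λ h(x, ·)`. -/
theorem gibbs_eq_tilted {n m : ℕ} (h : (Fin n → ℝ) → (Fin m → ℝ) → ℝ)
    (Q : Measure (Fin m → ℝ)) (lam : ℝ) (x : Fin n → ℝ)
    (hpos : 0 < ∫ y, Real.exp (-lam * h x y) ∂Q) :
    gibbs h Q lam x = Q.tilted fun y => -lam * h x y := by
  simp only [gibbs, cgfK, Measure.tilted, Real.exp_sub, Real.exp_log hpos]

theorem stmt3 {n m : ℕ} (h : (Fin n → ℝ) → (Fin m → ℝ) → ℝ)
    (hMeas : Measurable (Function.uncurry h))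
    (Q : Measure (Fin m → ℝ)) [IsProbabilityMeasure Q]
    (x : (Fin n → ℝ)) (lam : ℝ) (hlam : lam ≠ 0)
    (hKint : Integrable (fun y => Real.exp (-lam * h x y)) Q)
    (hKpos : 0 < ∫ y, Real.exp (-lam * h x y) ∂Q)
    (hQint : Integrable (h x) Q) :
    -(1 / lam) * cgfK h Q x (-lam)
      = (∫ y, h x y ∂Q) - (1 / lam) * klDivR Q (gibbs h Q lam x) := by
  have hkl : klDivR Q (gibbs h Q lam x) = lam * (∫ y, h x y ∂Q) + cgfK h Q x (-lam) := by
    have hllr : Integrable (llr Q Q) Q :=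
      (integrable_zero _ _ _).congr (llr_self Q).symm
    have hzero : ∫ y, llr Q Q y ∂Q = 0 := by
      rw [integral_congr_ae (llr_self Q)]
      simp
    rw [gibbs_eq_tilted h Q lam x hKpos]
    change ∫ y, llr Q (Q.tilted fun y => -lam * h x y) y ∂Q = _
    rw [integral_llr_tilted_right Measure.AbsolutelyContinuous.rfl
      (hQint.const_mul (-lam)) hKint hllr, hzero, integral_const_mul, cgfK]
    ring
  rw [hkl]
  field_simp
  ring
end

section
/- Let P^{(1)}_{Y|X} and P^{(2)}_{Y|X} be Markov kernels from ℝ^n to ℝ^m, let P_X be a probability measure on ℝ^n, let Q be a σ-finite measure on ℝ^m, and let λ ≠ 0. Assume that for all x ∈ ℝ^n: P^{(1)}_{Y|X=x} ≪ Q and P^{(2)}_{Y|X=x} ≪ Q; K_{h,Q,x}(−λ) is finite; h(x,·) is integrable with respect to P^{(1)}_{Y|X=x}, P^{(2)}_{Y|X=x}, and the (h,Q,λ)-Gibbs probability measure P^{(h,Q,λ)}_{Y|X=x}; and D(P^{(1)}_{Y|X=x}‖Q) and D(P^{(2)}_{Y|X=x}‖Q) are finite. Assume moreover that the function x ↦ G_h(x,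 P^{(1)}_{Y|X=x}, P^{(2)}_{Y|X=x}) is integrable with respect to P_X. Then the expected variation satisfies Ḡ_h(P^{(1)}_{Y|X}, P^{(2)}_{Y|X}, P_X) = (1/λ) ∫ ( D(P^{(1)}_{Y|X=x}‖P^{(h,Q,λ)}_{Y|X=x}) − D(P^{(2)}_{Y|X=x}‖P^{(h,Q,λ)}_{Y|X=x}) + D(P^{(2)}_{Y|X=x}‖Q) − D(P^{(1)}_{Y|X=x}‖Q) ) dP_X(x). -/
open MeasureTheory Real ProbabilityTheory

/-- The relative entropy with respect to a Gibbs measure differs from that with respect to its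
reference measure by an affine function of the mean of `h x`. -/
theorem klDivR_gibbs {n m : ℕ} (h : (Fin n → ℝ) → (Fin m → ℝ) → ℝ)
    (Q : Measure (Fin m → ℝ)) [SigmaFinite Q] (lam : ℝ) (x : Fin n → ℝ)
    (μ : Measure (Fin m → ℝ)) [IsProbabilityMeasure μ] (hac : μ ≪ Q)
    (hK : Integrable (fun y => Real.exp (-lam * h x y)) Q)
    (hKpos : 0 < ∫ y, Real.exp (-lam * h x y) ∂Q) (hInt : Integrable (h x) μ)
    (hKL : Integrable (llr μ Q) μ) :
    klDivR μ (gibbs h Q lam x) = klDivR μ Q + lam * (∫ y, h x y ∂μ) + cgfK h Q x (-lam) := by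
  have hg : gibbs h Q lam x = Q.tilted fun y => -lam * h x y := by
    simp only [gibbs, cgfK, Measure.tilted, Real.exp_sub, Real.exp_log hKpos]
  have hkl := integral_llr_tilted_right hac (hInt.const_mul (-lam)) hK hKL
  rw [integral_const_mul, ← hg] at hkl
  simp only [llr] at hkl
  rw [klDivR, hkl, klDivR, cgfK]
  ring

theorem stmt10 {n m : ℕ} (h : (Fin n → ℝ) → (Fin m → ℝ) → ℝ)
    (hMeas : Measurable (Function.uncurry h))
    (κ₁ κ₂ : Kernel (Fin n → ℝ) (Fin m → ℝ)) [IsMarkovKernel κ₁] [IsMarkovKernel κ₂]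
    (PX : Measure (Fin n → ℝ)) [IsProbabilityMeasure PX]
    (Q : Measure (Fin m → ℝ)) [SigmaFinite Q]
    (lam : ℝ) (hlam : lam ≠ 0)
    (hac1 : ∀ x, κ₁ x ≪ Q) (hac2 : ∀ x, κ₂ x ≪ Q)
    (hKint : ∀ x, Integrable (fun y => Real.exp (-lam * h x y)) Q)
    (hKpos : ∀ x, 0 < ∫ y, Real.exp (-lam * h x y) ∂Q)
    (hInt1 : ∀ x, Integrable (h x) (κ₁ x)) (hInt2 : ∀ x, Integrable (h x) (κ₂ x))
    (hGint : ∀ x, Integrable (h x) (gibbs h Q lam x))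
    (hKL1 : ∀ x, Integrable (fun y => Real.log (((κ₁ x).rnDeriv Q y).toReal)) (κ₁ x))
    (hKL2 : ∀ x, Integrable (fun y => Real.log (((κ₂ x).rnDeriv Q y).toReal)) (κ₂ x))
    (hOuter : Integrable (fun x => (∫ y, h x y ∂(κ₁ x)) - ∫ y, h x y ∂(κ₂ x)) PX) :
    ∫ x, ((∫ y, h x y ∂(κ₁ x)) - ∫ y, h x y ∂(κ₂ x)) ∂PX
      = (1 / lam) * ∫ x, (klDivR (κ₁ x) (gibbs h Q lam x) - klDivR (κ₂ x) (gibbs h Q lam x)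
          + klDivR (κ₂ x) Q - klDivR (κ₁ x) Q) ∂PX := by
  rw [← integral_const_mul]
  refine integral_congr_ae (.of_forall fun x => ?_)
  simp only
  rw [klDivR_gibbs h Q lam x (κ₁ x) (hac1 x) (hKint x) (hKpos x) (hInt1 x) (hKL1 x),
    klDivR_gibbs h Q lam x (κ₂ x) (hac2 x) (hKint x) (hKpos x) (hInt2 x) (hKL2 x)]
  field_simp
  ring
end

section
/- Let P_{Y|X} be a Markov kernel from ℝ^n to ℝ^m, let P_X be a probability measure on ℝ^n, let P_Y be the marginal of P_{Y|X} under P_X, let Q be a σ-finite measure on ℝ^m, and let λ ≠ 0. Assume that for all x ∈ ℝ^n: P_Y and P_{Y|X=x} are mutually absolutely continuous and both are absolutely continuous with respect to Q; K_{h,Q,x}(−λ) is finite; D(P_Y‖P_{Y|X=x}) is finite; and the function y ↦ log( dP_{Y|X=x}/dP^{(h,Q,λ)}_{Y|X=x} (y) ) is integrable with respect to P_Y, where P^{(h,Q,λ)}_{Y|X=x} is the (h,Q,λ)-Gibbs probability measure. Assume all outer integrals over P_X exist and are finite. Then ∫ D(P_Y‖P^{(h,Q,λ)}_{Y|X=x})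 dP_X(x) = L(P_{Y|X}; P_X) + ∫∫ log( dP_{Y|X=x}/dP^{(h,Q,λ)}_{Y|X=x} (y) ) dP_Y(y) dP_X(x). -/
open MeasureTheory Real ProbabilityTheory

/-- Chain rule: `D(μ‖ρ) = D(μ‖ν) + ∫ log (dν/dρ) dμ` whenever `μ ≪ ν ≪ ρ` and both terms on the
right are integrable. -/
theorem klDivR_eq_add_integral_log_rnDeriv {α : Type*} [MeasurableSpace α] {μ ν ρ : Measure α}
    [SigmaFinite μ] [SigmaFinite ν] [SigmaFinite ρ] (hμν : μ ≪ ν) (hνρ : ν ≪ ρ)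
    (hint : Integrable (fun y => Real.log ((μ.rnDeriv ν y).toReal)) μ)
    (hint' : Integrable (fun y => Real.log ((ν.rnDeriv ρ y).toReal)) μ) :
    klDivR μ ρ = klDivR μ ν + ∫ y, Real.log ((ν.rnDeriv ρ y).toReal) ∂μ := by
  unfold klDivR
  rw [← integral_add hint hint']
  refine integral_congr_ae ?_
  filter_upwards [(hμν.trans hνρ).ae_le (Measure.rnDeriv_mul_rnDeriv (κ := ρ) hμν),
    Measure.rnDeriv_pos hμν, hμν.ae_le (μ.rnDeriv_lt_top ν),
    hμν.ae_le (Measure.rnDeriv_pos hνρ), (hμν.trans hνρ).ae_le (ν.rnDeriv_lt_top ρ)]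
    with y hmul hpos hlt hpos' hlt'
  rw [← hmul, Pi.mul_apply, ENNReal.toReal_mul,
    Real.log_mul (ENNReal.toReal_pos hpos.ne' hlt.ne).ne'
      (ENNReal.toReal_pos hpos'.ne' hlt'.ne).ne']

theorem stmt15 {n m : ℕ} (h : (Fin n → ℝ) → (Fin m → ℝ) → ℝ)
    (hMeas : Measurable (Function.uncurry h))
    (κ : Kernel (Fin n → ℝ) (Fin m → ℝ)) [IsMarkovKernel κ]
    (PX : Measure (Fin n → ℝ)) [IsProbabilityMeasure PX]
    (PY : Measure (Fin m → ℝ)) (hPY : PY = PX.bind (fun x => κ x))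
    (Q : Measure (Fin m → ℝ)) [SigmaFinite Q]
    (lam : ℝ) (hlam : lam ≠ 0)
    (hmut1 : ∀ x, PY ≪ κ x) (hmut2 : ∀ x, κ x ≪ PY)
    (hacY : PY ≪ Q) (hacK : ∀ x, κ x ≪ Q)
    (hKint : ∀ x, Integrable (fun y => Real.exp (-lam * h x y)) Q)
    (hKpos : ∀ x, 0 < ∫ y, Real.exp (-lam * h x y) ∂Q)
    (hL : ∀ x, Integrable (fun y => Real.log ((PY.rnDeriv (κ x) y).toReal)) PY)
    (hlogY : ∀ x, Integrable (fun y => Real.log (((κ x).rnDeriv (gibbs h Q lam x) y).toReal)) PY)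
    (hOuterL : Integrable (fun x => klDivR PY (κ x)) PX)
    (hOuterG : Integrable (fun x => klDivR PY (gibbs h Q lam x)) PX)
    (hOuterY : Integrable (fun x => ∫ y, Real.log (((κ x).rnDeriv (gibbs h Q lam x) y).toReal) ∂PY) PX) :
    ∫ x, klDivR PY (gibbs h Q lam x) ∂PX
      = (∫ x, klDivR PY (κ x) ∂PX)
        + ∫ x, ∫ y, Real.log (((κ x).rnDeriv (gibbs h Q lam x) y).toReal) ∂PY ∂PX := by
  have : IsProbabilityMeasure PY := by
    rw [hPY]
    infer_instance
  rw [← integral_add hOuterL hOuterY]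
  congr 1 with x
  have hx : Measurable (h x) := hMeas.of_uncurry_left
  have hdens : Measurable fun y => Real.exp (-lam * h x y - cgfK h Q x (-lam)) := by fun_prop
  have hQ : Q ≪ gibbs h Q lam x :=
    withDensity_absolutelyContinuous' hdens.ennreal_ofReal.aemeasurable <|
      .of_forall fun y => (ENNReal.ofReal_pos.2 (Real.exp_pos _)).ne'
  have : SigmaFinite (gibbs h Q lam x) :=
    SigmaFinite.withDensity_ofReal _
  exact klDivR_eq_add_integral_log_rnDeriv (hmut1 x) ((hacK x).trans hQ) (hL x) (hlogY x)
end

section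
/- Let Q be a σ-finite measure on ℝ^m, let λ ≠ 0, and assume K_{h,Q,x}(−λ) is finite for all x ∈ ℝ^n, so that the (h,Q,λ)-Gibbs conditional probability measure P^{(h,Q,λ)}_{Y|X} = (P^{(h,Q,λ)}_{Y|X=x})_{x∈ℝ^n} is defined; assume it is a Markov kernel from ℝ^n to ℝ^m. Let P_X be a probability measure on ℝ^n and let P^{(h,Q,λ)}_Y be the marginal of P^{(h,Q,λ)}_{Y|X} under P_X, i.e., P^{(h,Q,λ)}_Y(A) = ∫ P^{(h,Q,λ)}_{Y|X=x}(A) dP_X(x) for all Borel sets A. Assume that for all x ∈ ℝ^n, h(x,·) is integrable with respect to P^{(h,Q,λ)}_Y and P^{(h,Q,λ)}_{Y|X=x}; that P^{(h,Q,λ)}_Y and P^{(h,Q,λ)}_{Y|X=x} are mutually absolutely continuous with D(P^{(h,Q,λ)}_Y‖Q) and D(P^{(h,Q,λ)}_{Y|X=x}‖Q) finite; and that I(P^{(h,Q,λ)}_{Y|X}; P_X) and L(P^{(h,Q,λ)}_{Y|X}; P_X) are finite. Then Ḡ_h(P^{(h,Q,λ)}_Y, P^{(h,Q,λ)}_{Y|X},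 P_X) = (1/λ) ( I(P^{(h,Q,λ)}_{Y|X}; P_X) + L(P^{(h,Q,λ)}_{Y|X}; P_X) ). -/
open MeasureTheory Real ProbabilityTheory

/-- The log-density of a Gibbs measure with respect to its reference measure. -/
lemma log_rnDeriv_gibbs {n m : ℕ} {h : (Fin n → ℝ) → (Fin m → ℝ) → ℝ}
    (hMeas : Measurable (Function.uncurry h)) (Q : Measure (Fin m → ℝ)) [SigmaFinite Q]
    (lam : ℝ) (x : Fin n → ℝ) :
    ∀ᵐ y ∂Q, Real.log (((gibbs h Q lam x).rnDeriv Q y).toReal)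
      = -lam * h x y - cgfK h Q x (-lam) := by
  have hx : Measurable (h x) := hMeas.of_uncurry_left
  have hd : Measurable fun y =>
      ENNReal.ofReal (Real.exp (-lam * h x y - cgfK h Q x (-lam))) := by fun_prop
  filter_upwards [Measure.rnDeriv_withDensity Q hd] with y hy
  rw [gibbs, hy, ENNReal.toReal_ofReal (Real.exp_pos _).le, Real.log_exp]

/-- The chain rule for log-likelihood ratios of measures. -/
lemma llr_eq_llr_sub_llr {α : Type*} [MeasurableSpace α] {μ ν ξ : Measure α}
    [SigmaFinite μ] [SigmaFinite ν] [SigmaFinite ξ] (hνμ : ν ≪ μ) (hνξ : ν ≪ ξ) :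
    llr μ ν =ᵐ[ν] fun y => llr μ ξ y - llr ν ξ y := by
  filter_upwards [Measure.rnDeriv_mul_rnDeriv' (μ := μ) hνξ, Measure.rnDeriv_pos' hνμ,
    Measure.rnDeriv_ne_top μ ν, Measure.rnDeriv_pos hνξ,
    hνξ (Measure.rnDeriv_ne_top ν ξ)] with y hy h1 h2 h3 h4
  simp only [llr, ← hy, Pi.mul_apply, ENNReal.toReal_mul]
  rw [Real.log_mul (ENNReal.toReal_pos h1.ne' h2).ne' (ENNReal.toReal_pos h3.ne' h4).ne']
  ring

/-- The symmetrized divergence between a Gibbs measure and an equivalent measure. -/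
lemma klDivR_gibbs_add_klDivR {n m : ℕ} {h : (Fin n → ℝ) → (Fin m → ℝ) → ℝ}
    (hMeas : Measurable (Function.uncurry h)) {Q P : Measure (Fin m → ℝ)} [SigmaFinite Q]
    [IsProbabilityMeasure P] {lam : ℝ} {x : Fin n → ℝ} [IsProbabilityMeasure (gibbs h Q lam x)]
    (hP : Integrable (h x) P) (hG : Integrable (h x) (gibbs h Q lam x))
    (hPG : P ≪ gibbs h Q lam x) (hGP : gibbs h Q lam x ≪ P)
    (hPQ : Integrable (llr P Q) P)
    (hint : Integrable (llr (gibbs h Q lam x) P) (gibbs h Q lam x)) :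
    klDivR (gibbs h Q lam x) P + klDivR P (gibbs h Q lam x)
      = lam * ((∫ y, h x y ∂P) - ∫ y, h x y ∂(gibbs h Q lam x))
        + ((∫ y, llr P Q y ∂P) - ∫ y, llr P Q y ∂(gibbs h Q lam x)) := by
  set G := gibbs h Q lam x with hGdef
  have hGQ : G ≪ Q := withDensity_absolutelyContinuous _ _
  have key : ∀ᵐ y ∂P, llr G P y = (-lam * h x y - cgfK h Q x (-lam)) - llr P Q y := by
    filter_upwards [llr_eq_llr_sub_llr hPG (hPG.trans hGQ),
      (hPG.trans hGQ) (log_rnDeriv_gibbs hMeas Q lam x)] with y h1 h2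
    rw [h1, ← h2]
    rfl
  have iP : Integrable (fun y => -lam * h x y - cgfK h Q x (-lam)) P :=
    (hP.const_mul _).sub (integrable_const _)
  have iG : Integrable (fun y => -lam * h x y - cgfK h Q x (-lam)) G :=
    (hG.const_mul _).sub (integrable_const _)
  have iGP : Integrable (llr P Q) G := by
    refine (iG.sub hint).congr ?_
    filter_upwards [hGP key] with y hy
    simp only [Pi.sub_apply, hy]
    ring
  have e1 : klDivR G P
      = (∫ y, (-lam * h x y - cgfK h Q x (-lam)) ∂G) - ∫ y, llr P Q y ∂G := by
    rw [← integral_sub iG iGP]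
    exact integral_congr_ae (hGP key)
  have e2 : klDivR P G
      = (∫ y, llr P Q y ∂P) - ∫ y, (-lam * h x y - cgfK h Q x (-lam)) ∂P := by
    rw [← integral_sub hPQ iP]
    refine integral_congr_ae ?_
    filter_upwards [key, neg_llr hPG] with y h1 h2
    change llr P G y = _
    rw [Pi.neg_apply, h1] at h2
    linarith
  rw [e1, e2, integral_sub (hG.const_mul _) (integrable_const _),
    integral_sub (hP.const_mul _) (integrable_const _), integral_const_mul, integral_const_mul]
  simp
  ring

theorem stmt16 {n m : ℕ} (h : (Fin n → ℝ) → (Fin m → ℝ) → ℝ)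
    (hMeas : Measurable (Function.uncurry h))
    (Q : Measure (Fin m → ℝ)) [SigmaFinite Q]
    (lam : ℝ) (hlam : lam ≠ 0)
    (hKint : ∀ x, Integrable (fun y => Real.exp (-lam * h x y)) Q)
    (hKpos : ∀ x, 0 < ∫ y, Real.exp (-lam * h x y) ∂Q)
    (κ : Kernel (Fin n → ℝ) (Fin m → ℝ)) [IsMarkovKernel κ]
    (hκ : ∀ x, κ x = gibbs h Q lam x)
    (PX : Measure (Fin n → ℝ)) [IsProbabilityMeasure PX]
    (PY : Measure (Fin m → ℝ)) (hPY : PY = PX.bind (fun x => κ x))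
    (hIntY : ∀ x, Integrable (h x) PY) (hIntK : ∀ x, Integrable (h x) (κ x))
    (hmut1 : ∀ x, PY ≪ κ x) (hmut2 : ∀ x, κ x ≪ PY)
    (hKLYQ : Integrable (fun y => Real.log ((PY.rnDeriv Q y).toReal)) PY)
    (hKLKQ : ∀ x, Integrable (fun y => Real.log (((κ x).rnDeriv Q y).toReal)) (κ x))
    (hIinner : ∀ x, Integrable (fun y => Real.log (((κ x).rnDeriv PY y).toReal)) (κ x))
    (hLinner : ∀ x, Integrable (fun y => Real.log ((PY.rnDeriv (κ x) y).toReal)) PY)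
    (hIouter : Integrable (fun x => klDivR (κ x) PY) PX)
    (hLouter : Integrable (fun x => klDivR PY (κ x)) PX)
    (hOuterG : Integrable (fun x => (∫ y, h x y ∂PY) - ∫ y, h x y ∂(κ x)) PX) :
    ∫ x, ((∫ y, h x y ∂PY) - ∫ y, h x y ∂(κ x)) ∂PX
      = (1 / lam) * ((∫ x, klDivR (κ x) PY ∂PX) + ∫ x, klDivR PY (κ x) ∂PX) := by
  have hPY' : PY = κ ∘ₘ PX := hPY
  have : IsProbabilityMeasure PY := by
    rw [hPY']
    infer_instance
  have hcomp_const : PY = (κ ∘ₖ Kernel.const Unit PX) () := by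
    rw [hPY', Measure.comp_eq_comp_const_apply]
  have hκPY : Integrable (llr PY Q) ((κ ∘ₖ Kernel.const Unit PX) ()) := by
    rw [← hcomp_const]
    exact hKLYQ
  have hcomp : ∫ x, ∫ y, llr PY Q y ∂(κ x) ∂PX = ∫ y, llr PY Q y ∂PY := by
    have hc := Kernel.integral_comp hκPY
    rw [← hcomp_const, Kernel.const_apply] at hc
    exact hc.symm
  have hsum : ∀ x, klDivR (κ x) PY + klDivR PY (κ x)
      = lam * ((∫ y, h x y ∂PY) - ∫ y, h x y ∂(κ x))
        + ((∫ y, llr PY Q y ∂PY) - ∫ y, llr PY Q y ∂(κ x)) := by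
    intro x
    have : IsProbabilityMeasure (gibbs h Q lam x) := by
      rw [← hκ x]
      infer_instance
    have h1 := hIntK x
    have h2 := hmut1 x
    have h3 := hmut2 x
    have h4 := hIinner x
    rw [hκ x] at h1 h2 h3 h4 ⊢
    exact klDivR_gibbs_add_klDivR hMeas (hIntY x) h1 h2 h3 hKLYQ h4
  have hint : Integrable (fun x => ∫ y, llr PY Q y ∂(κ x)) PX := by
    simpa only [Kernel.const_apply] using hκPY.integral_comp
  have hdiff : Integrable (fun x => (∫ y, llr PY Q y ∂PY) - ∫ y, llr PY Q y ∂(κ x)) PX :=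
    (integrable_const _).sub hint
  rw [← integral_add hIouter hLouter, integral_congr_ae (.of_forall hsum),
    integral_add (hOuterG.const_mul _) hdiff, integral_const_mul,
    integral_sub (integrable_const _) hint, hcomp]
  simp [hlam]
end
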